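/- arXiv:0901.1883 — 2 statements merged into one kernel-verified Lean document; each statement's English description precedes it below -/
import Mathlib

section
/- Let ρ be as above. Then ∫_0^∞ ρ(y) log(y) dy = log(2) − 1. -/
noncomputable def rho : ℝ → ℝ := fun x =>
  if x < 0 then 0
  else if x ≤ 1 / 2 then 1
  else (2 / Real.pi) * (Real.arctan (1 / Real.sqrt (2 * x - 1)) - Real.sqrt (2 * x - 1) / (2 * x))

open Real Set Filter Topology MeasureTheory

lemma sin_pos_of_mem_Ioo_pi_div_two {φ : ℝ} (h : φ ∈ Ioo 0 (π / 2)) : 0 < sin φ :=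
  sin_pos_of_pos_of_lt_pi h.1 (by linarith [h.2, pi_pos])

lemma cos_pos_of_mem_Ioo_pi_div_two {φ : ℝ} (h : φ ∈ Ioo 0 (π / 2)) : 0 < cos φ :=
  cos_pos_of_mem_Ioo ⟨by linarith [h.1, pi_pos], h.2⟩

lemma sub_sin_mul_cos_nonneg {φ : ℝ} (h : 0 ≤ φ) : 0 ≤ φ - sin φ * cos φ := by
  have := sin_le (x := 2 * φ) (by linarith)
  rw [sin_two_mul] at this
  linarith

lemma sub_sin_mul_cos_le {φ : ℝ} (h : φ ∈ Ioo 0 (π / 2)) :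
    φ - sin φ * cos φ ≤ π * sin φ ^ 3 := by
  have hs := sin_pos_of_mem_Ioo_pi_div_two h
  have hc := cos_pos_of_mem_Ioo_pi_div_two h
  have key : 2 * φ * cos (2 * φ) ≤ sin (2 * φ) := by
    rcases lt_or_ge (2 * φ) (π / 2) with h2 | h2
    · have hc2 : 0 < cos (2 * φ) := cos_pos_of_mem_Ioo ⟨by linarith [h.1, pi_pos], h2⟩
      have := le_tan (x := 2 * φ) (by linarith [h.1]) h2
      rwa [tan_eq_sin_div_cos, le_div_iff₀ hc2] at this
    · have h3 : cos (2 * φ) ≤ 0 :=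
        cos_nonpos_of_pi_div_two_le_of_le h2 (by linarith [h.2, pi_pos])
      have h4 : 0 ≤ sin (2 * φ) := by rw [sin_two_mul]; positivity
      nlinarith [h.1]
  have hj : 2 * φ ≤ π * sin φ := by
    have := mul_le_sin h.1.le h.2.le
    rw [div_mul_eq_mul_div, div_le_iff₀ pi_pos] at this
    linarith
  rw [cos_two_mul, sin_two_mul, cos_sq'] at key
  nlinarith [mul_le_mul_of_nonneg_right hj (sq_nonneg (sin φ))]

lemma hasDerivAt_inv_two_mul_sin_sq {φ : ℝ} (h : sin φ ≠ 0) :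
    HasDerivAt (fun φ => 1 / (2 * sin φ ^ 2)) (-(cos φ / sin φ ^ 3)) φ := by
  have h1 : HasDerivAt (fun φ => 2 * sin φ ^ 2) (2 * (2 * sin φ * cos φ)) φ := by
    simpa using ((hasDerivAt_sin φ).pow 2).const_mul 2
  refine ((hasDerivAt_const φ (1 : ℝ)).fun_div h1 (by positivity)).congr_deriv ?_
  field_simp
  ring

lemma injOn_inv_two_mul_sin_sq :
    InjOn (fun φ => 1 / (2 * sin φ ^ 2)) (Ioo 0 (π / 2)) := by
  intro a ha b hb hab
  have hsa := sin_pos_of_mem_Ioo_pi_div_two ha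
  have hsb := sin_pos_of_mem_Ioo_pi_div_two hb
  have h1 : sin a ^ 2 = sin b ^ 2 := by
    have : 1 / (2 * sin a ^ 2) = 1 / (2 * sin b ^ 2) := hab
    field_simp at this
    exact this.symm
  have h2 : sin a = sin b := (sq_eq_sq₀ hsa.le hsb.le).1 h1
  exact injOn_sin ⟨by linarith [ha.1, pi_pos], ha.2.le⟩ ⟨by linarith [hb.1, pi_pos], hb.2.le⟩ h2

lemma image_inv_two_mul_sin_sq :
    (fun φ => 1 / (2 * sin φ ^ 2)) '' Ioo 0 (π / 2) = Ioi (1 / 2) := by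
  ext y
  constructor
  · rintro ⟨φ, hφ, rfl⟩
    have hs := sin_pos_of_mem_Ioo_pi_div_two hφ
    have hc := cos_pos_of_mem_Ioo_pi_div_two hφ
    have : sin φ ^ 2 < 1 := by nlinarith [sin_sq_add_cos_sq φ]
    have h2 : (1 : ℝ) / 2 < 1 / (2 * sin φ ^ 2) :=
      one_div_lt_one_div_of_lt (by positivity) (by linarith)
    exact h2
  · intro hy
    have hy' : (1 : ℝ) / 2 < y := hy
    have h0 : 0 < 1 / (2 * y) := by positivity
    have h1 : √(1 / (2 * y)) < 1 := by
      rw [sqrt_lt' one_pos, div_lt_iff₀ (by linarith)]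
      linarith
    have h2 : 0 < √(1 / (2 * y)) := sqrt_pos.2 h0
    refine ⟨arcsin √(1 / (2 * y)), ⟨arcsin_pos.2 h2, arcsin_lt_pi_div_two.2 h1⟩, ?_⟩
    simp only
    rw [sin_arcsin (by linarith) h1.le, sq_sqrt h0.le]
    have : y ≠ 0 := by linarith
    field_simp

lemma rho_inv_two_mul_sin_sq {φ : ℝ} (h : φ ∈ Ioo 0 (π / 2)) :
    rho (1 / (2 * sin φ ^ 2)) = 2 / π * (φ - sin φ * cos φ) := by
  have hs := sin_pos_of_mem_Ioo_pi_div_two h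
  have hc := cos_pos_of_mem_Ioo_pi_div_two h
  have hx : 1 / 2 < 1 / (2 * sin φ ^ 2) := by
    have : 1 / (2 * sin φ ^ 2) ∈ Ioi ((1 : ℝ) / 2) :=
      image_inv_two_mul_sin_sq ▸ mem_image_of_mem _ h
    exact this
  have hsqrt : √(2 * (1 / (2 * sin φ ^ 2)) - 1) = cos φ / sin φ := by
    rw [← sqrt_sq (div_pos hc hs).le, div_pow, cos_sq']
    congr 1
    field_simp
  have harctan : arctan (1 / (cos φ / sin φ)) = φ := by
    rw [one_div_div, ← tan_eq_sin_div_cos, arctan_tan (by linarith [h.1, pi_pos]) h.2]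
  rw [rho, if_neg (by linarith), if_neg (by linarith), hsqrt, harctan]
  field_simp

lemma log_inv_two_mul_sin_sq {φ : ℝ} (h : sin φ ≠ 0) :
    log (1 / (2 * sin φ ^ 2)) = -(log 2 + 2 * log (sin φ)) := by
  rw [one_div, log_inv, log_mul two_ne_zero (by positivity), log_pow]
  norm_num

lemma intervalIntegrable_log_two_add_two_mul_log_sin (a b : ℝ) :
    IntervalIntegrable (fun φ => log 2 + 2 * log (sin φ)) volume a b :=
  intervalIntegrable_const.add (intervalIntegrable_log_sin.const_mul 2)

lemma integrableOn_trig_integrand :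
    IntegrableOn (fun φ => cos φ / sin φ ^ 3 * (φ - sin φ * cos φ) * (log 2 + 2 * log (sin φ)))
      (Ioo 0 (π / 2)) := by
  have hL : IntegrableOn (fun φ => log 2 + 2 * log (sin φ)) (Ioo 0 (π / 2)) :=
    ((intervalIntegrable_iff_integrableOn_Ioc_of_le pi_div_two_pos.le).1
      (intervalIntegrable_log_two_add_two_mul_log_sin 0 (π / 2))).mono_set Ioo_subset_Ioc_self
  refine hL.bdd_mul (c := π) ?_ ?_
  · exact Measurable.aestronglyMeasurable (by fun_prop)
  · refine (ae_restrict_iff' measurableSet_Ioo).2 (Eventually.of_forall fun φ h => ?_)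
    have hs := sin_pos_of_mem_Ioo_pi_div_two h
    have hc := cos_pos_of_mem_Ioo_pi_div_two h
    have hw := sub_sin_mul_cos_nonneg h.1.le
    rw [norm_of_nonneg (by positivity), div_mul_eq_mul_div, div_le_iff₀ (by positivity)]
    nlinarith [sub_sin_mul_cos_le h, cos_le_one φ]

lemma hasDerivAt_trig_primitive {φ : ℝ} (h : sin φ ≠ 0) :
    HasDerivAt (fun φ => (φ - sin φ * cos φ) * (1 / (2 * sin φ ^ 2)) *
        (log 2 + 2 * log (sin φ) + 1))
      (-(cos φ / sin φ ^ 3 * (φ - sin φ * cos φ) * (log 2 + 2 * log (sin φ))) +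
        (log 2 + 2 * log (sin φ) + 1)) φ := by
  have h1 : HasDerivAt (fun φ => φ - sin φ * cos φ) (2 * sin φ ^ 2) φ := by
    have h3 := (hasDerivAt_id' φ).fun_sub ((hasDerivAt_sin φ).fun_mul (hasDerivAt_cos φ))
    have e : 1 - (cos φ * cos φ + sin φ * -sin φ) = 2 * sin φ ^ 2 := by
      linear_combination -sin_sq_add_cos_sq φ
    rwa [e] at h3
  have h2 : HasDerivAt (fun φ => log 2 + 2 * log (sin φ) + 1) (2 * (cos φ / sin φ)) φ :=
    ((((hasDerivAt_sin φ).log h).const_mul 2).const_add (log 2)).add_const 1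
  refine ((h1.fun_mul (hasDerivAt_inv_two_mul_sin_sq h)).fun_mul h2).congr_deriv ?_
  field_simp
  ring

lemma continuousOn_trig_primitive :
    ContinuousOn (fun φ => (φ - sin φ * cos φ) * (1 / (2 * sin φ ^ 2)) *
        (log 2 + 2 * log (sin φ) + 1)) (Icc 0 (π / 2)) := by
  intro φ hφ
  rcases hφ.1.eq_or_lt with rfl | h0
  · have hlim : Tendsto (fun φ => π / 2 * |(log 2 + 1) * sin φ + 2 * (sin φ * log (sin φ))|)
        (𝓝[Icc 0 (π / 2)] 0) (𝓝 0) := by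
      have : Continuous fun φ => π / 2 * |(log 2 + 1) * sin φ + 2 * (sin φ * log (sin φ))| := by
        have := continuous_mul_log.comp continuous_sin
        simp only [Function.comp_def] at this
        fun_prop
      simpa using (this.tendsto 0).mono_left nhdsWithin_le_nhds
    rw [ContinuousWithinAt]
    simp only [sin_zero, zero_mul, sub_zero]
    refine squeeze_zero_norm' ?_ hlim
    filter_upwards [self_mem_nhdsWithin, mem_nhdsWithin_of_mem_nhds
      (Iio_mem_nhds pi_div_two_pos)] with x hx hx'
    rcases hx.1.eq_or_lt with rfl | hx0
    · simp
    have hs := sin_pos_of_mem_Ioo_pi_div_two ⟨hx0, hx'⟩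
    have hw := sub_sin_mul_cos_nonneg hx0.le
    have hw' := sub_sin_mul_cos_le ⟨hx0, hx'⟩
    have e : (log 2 + 1) * sin x + 2 * (sin x * log (sin x)) =
      sin x * (log 2 + 2 * log (sin x) + 1) := by ring
    rw [e, norm_mul, norm_of_nonneg (by positivity), abs_mul, abs_of_pos hs, ← mul_assoc,
      norm_eq_abs]
    refine mul_le_mul_of_nonneg_right ?_ (abs_nonneg _)
    rw [mul_one_div, div_le_iff₀ (by positivity)]
    linarith
  · have hs : sin φ ≠ 0 := (sin_pos_of_pos_of_lt_pi h0 (by linarith [hφ.2, pi_pos])).ne'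
    exact (hasDerivAt_trig_primitive hs).continuousAt.continuousWithinAt

lemma integral_trig_integrand :
    ∫ φ in Ioo 0 (π / 2),
      cos φ / sin φ ^ 3 * (φ - sin φ * cos φ) * (log 2 + 2 * log (sin φ)) =
      π / 2 * (1 / 2 - 3 / 2 * log 2) := by
  have hint : IntervalIntegrable (fun φ => cos φ / sin φ ^ 3 * (φ - sin φ * cos φ) *
      (log 2 + 2 * log (sin φ))) volume 0 (π / 2) :=
    (intervalIntegrable_iff_integrableOn_Ioo_of_le pi_div_two_pos.le).2
      integrableOn_trig_integrand
  have hL := intervalIntegrable_log_two_add_two_mul_log_sin 0 (π / 2)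
  have hL1 : IntervalIntegrable (fun φ => log 2 + 2 * log (sin φ) + 1) volume 0 (π / 2) :=
    hL.add intervalIntegrable_const
  have hLint : ∫ φ in (0)..(π / 2), (log 2 + 2 * log (sin φ) + 1) = π / 2 * (1 - log 2) := by
    have hls : IntervalIntegrable (fun φ => 2 * log (sin φ)) volume 0 (π / 2) :=
      intervalIntegrable_log_sin.const_mul 2
    rw [intervalIntegral.integral_add hL intervalIntegrable_const,
      intervalIntegral.integral_add intervalIntegrable_const hls,
      intervalIntegral.integral_const_mul, integral_log_sin_zero_pi_div_two]
    simp only [intervalIntegral.integral_const, smul_eq_mul]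
    ring
  have hftc := intervalIntegral.integral_eq_sub_of_hasDeriv_right
    (by rw [uIcc_of_le pi_div_two_pos.le]; exact continuousOn_trig_primitive)
    (fun φ hφ => by
      rw [min_eq_left pi_div_two_pos.le, max_eq_right pi_div_two_pos.le] at hφ
      exact (hasDerivAt_trig_primitive
        (sin_pos_of_mem_Ioo_pi_div_two hφ).ne').hasDerivWithinAt)
    (hint.neg.add hL1)
  rw [intervalIntegral.integral_add hint.neg hL1, hLint] at hftc
  simp only [Pi.neg_apply, intervalIntegral.integral_neg] at hftc
  simp only [sin_pi_div_two, cos_pi_div_two, sin_zero, log_one] at hftc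
  rw [← integral_Ioc_eq_integral_Ioo, ← intervalIntegral.integral_of_le pi_div_two_pos.le]
  linarith

lemma abs_deriv_smul_rho_mul_log {φ : ℝ} (h : φ ∈ Ioo 0 (π / 2)) :
    |-(cos φ / sin φ ^ 3)| • (rho (1 / (2 * sin φ ^ 2)) * log (1 / (2 * sin φ ^ 2))) =
      -(2 / π) * (cos φ / sin φ ^ 3 * (φ - sin φ * cos φ) * (log 2 + 2 * log (sin φ))) := by
  have hs := sin_pos_of_mem_Ioo_pi_div_two h
  have hc := cos_pos_of_mem_Ioo_pi_div_two h
  rw [abs_neg, abs_of_pos (by positivity), rho_inv_two_mul_sin_sq h,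
    log_inv_two_mul_sin_sq hs.ne', smul_eq_mul]
  ring

lemma integrableOn_rho_mul_log_Ioi :
    IntegrableOn (fun y => rho y * log y) (Ioi (1 / 2)) := by
  rw [← image_inv_two_mul_sin_sq, integrableOn_image_iff_integrableOn_abs_deriv_smul
    measurableSet_Ioo (fun φ hφ => (hasDerivAt_inv_two_mul_sin_sq
      (sin_pos_of_mem_Ioo_pi_div_two hφ).ne').hasDerivWithinAt) injOn_inv_two_mul_sin_sq]
  exact (integrableOn_congr_fun (fun φ hφ => abs_deriv_smul_rho_mul_log hφ)
    measurableSet_Ioo).2 (integrableOn_trig_integrand.const_mul _)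

lemma integral_rho_mul_log_Ioi :
    ∫ y in Ioi (1 / 2), rho y * log y = 3 / 2 * log 2 - 1 / 2 := by
  rw [← image_inv_two_mul_sin_sq, integral_image_eq_integral_abs_deriv_smul
    measurableSet_Ioo (fun φ hφ => (hasDerivAt_inv_two_mul_sin_sq
      (sin_pos_of_mem_Ioo_pi_div_two hφ).ne').hasDerivWithinAt) injOn_inv_two_mul_sin_sq,
    setIntegral_congr_fun measurableSet_Ioo (fun φ hφ => abs_deriv_smul_rho_mul_log hφ),
    integral_const_mul, integral_trig_integrand]
  field_simp
  ring

lemma rho_mul_log_eq_log {y : ℝ} (hy : y ∈ Ioc 0 (1 / 2)) : rho y * log y = log y := by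
  rw [rho, if_neg hy.1.not_gt, if_pos hy.2, one_mul]

theorem rho_log_zero :
    ∫ y in Set.Ioi (0 : ℝ), rho y * Real.log y = Real.log 2 - 1 := by
  have hlog : IntegrableOn log (Ioc 0 (1 / 2)) :=
    (intervalIntegrable_iff_integrableOn_Ioc_of_le (by norm_num)).1
      intervalIntegral.intervalIntegrable_log'
  have hint : IntegrableOn (fun y => rho y * log y) (Ioc 0 (1 / 2)) :=
    (integrableOn_congr_fun (fun y hy => rho_mul_log_eq_log hy) measurableSet_Ioc).2 hlog
  rw [← Ioc_union_Ioi_eq_Ioi (show (0 : ℝ) ≤ 1 / 2 by norm_num),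
    setIntegral_union Ioc_disjoint_Ioi_same measurableSet_Ioi hint integrableOn_rho_mul_log_Ioi,
    integral_rho_mul_log_Ioi,
    setIntegral_congr_fun measurableSet_Ioc (fun y hy => rho_mul_log_eq_log hy),
    ← intervalIntegral.integral_of_le (by norm_num), integral_log, one_div, log_inv]
  ring
end

section
/- Let ρ be as above. For every x ≥ 1/2, ∫_0^∞ ρ(y) log|x − y| dy = log(x). -/
open MeasureTheory Set

lemma intervalIntegrable_log_cos_sub (c a b : ℝ) :
    IntervalIntegrable (fun φ => Real.log (Real.cos φ - c)) volume a b := by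
  have h : MeromorphicOn (fun φ : ℝ => Real.cos φ - c) (uIcc a b) := fun φ _ => by fun_prop
  exact h.intervalIntegrable_log

lemma countable_cos_eq (c : ℝ) : {φ : ℝ | Real.cos φ = c}.Countable := by
  refine (((countable_singleton (⟨c, -√(1 - c ^ 2)⟩ : ℂ)).insert
    (⟨c, √(1 - c ^ 2)⟩ : ℂ)).preimage_circleMap 0 one_ne_zero).mono ?_
  intro φ hφ
  have hs : √(1 - c ^ 2) = |Real.sin φ| := by
    rw [← Real.sqrt_sq_eq_abs, Real.sin_sq, ← hφ]
  rcases abs_choice (Real.sin φ) with h | h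
  · left
    apply Complex.ext <;> simp_all [circleMap, Complex.exp_ofReal_mul_I_re, Complex.exp_ofReal_mul_I_im]
  · right
    apply Complex.ext <;> simp_all [circleMap, Complex.exp_ofReal_mul_I_re, Complex.exp_ofReal_mul_I_im]

lemma ae_cos_ne (c : ℝ) : ∀ᵐ φ : ℝ, Real.cos φ ≠ c :=
  (countable_cos_eq c).ae_notMem volume

lemma integral_log_cos_sub_zero_two_pi {c : ℝ} (hc : c ∈ Icc (-1 : ℝ) 1) :
    ∫ φ in (0 : ℝ)..2 * Real.pi, Real.log (Real.cos φ - c) = -(2 * Real.pi * Real.log 2) := by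
  have key : ∀ a : ℂ, ‖a‖ = 1 → IntervalIntegrable (fun φ => Real.log ‖circleMap 0 1 φ - a‖)
      volume 0 (2 * Real.pi) ∧
      ∫ φ in (0 : ℝ)..2 * Real.pi, Real.log ‖circleMap 0 1 φ - a‖ = 0 := by
    intro a ha
    refine ⟨circleIntegrable_log_norm_sub_const (c := 0) 1, ?_⟩
    have := circleAverage_log_norm_sub_const₁ ha
    simpa [Real.circleAverage, Real.pi_ne_zero] using this
  have hs : √(1 - c ^ 2) ^ 2 = 1 - c ^ 2 := Real.sq_sqrt (by nlinarith [hc.1, hc.2])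
  set s := √(1 - c ^ 2)
  have h1 : ‖(⟨c, s⟩ : ℂ)‖ = 1 := by
    rw [Complex.norm_def, Complex.normSq_mk]
    simp [show c * c + s * s = 1 by linarith]
  have h2 : ‖(⟨c, -s⟩ : ℂ)‖ = 1 := by
    rw [Complex.norm_def, Complex.normSq_mk]
    simp [show c * c + s * s = 1 by linarith]
  obtain ⟨i1, e1⟩ := key _ h1
  obtain ⟨i2, e2⟩ := key _ h2
  have : ∫ φ in (0 : ℝ)..2 * Real.pi, Real.log (Real.cos φ - c) =
      ∫ φ in (0 : ℝ)..2 * Real.pi, ((Real.log ‖circleMap 0 1 φ - ⟨c, s⟩‖ +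
        Real.log ‖circleMap 0 1 φ - ⟨c, -s⟩‖) - Real.log 2) := by
    apply intervalIntegral.integral_congr_ae
    filter_upwards [ae_cos_ne c] with φ hφ _
    have hprod : ‖circleMap 0 1 φ - ⟨c, s⟩‖ * ‖circleMap 0 1 φ - ⟨c, -s⟩‖ =
        2 * |Real.cos φ - c| := by
      have : (circleMap 0 1 φ - ⟨c, s⟩) * (circleMap 0 1 φ - ⟨c, -s⟩) =
          circleMap 0 1 φ * ((2 * (Real.cos φ - c) : ℝ) : ℂ) := by
        have := Real.sin_sq_add_cos_sq φ
        apply Complex.ext <;>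
          simp [circleMap, Complex.exp_ofReal_mul_I_re, Complex.exp_ofReal_mul_I_im,
            -Complex.ofReal_cos, -Complex.ofReal_sub, -Complex.ofReal_mul] <;>
          linarith
      rw [← norm_mul, this, norm_mul, Complex.norm_real, Real.norm_eq_abs, abs_mul]
      simp
    have hne : |Real.cos φ - c| ≠ 0 := abs_ne_zero.2 (sub_ne_zero.2 hφ)
    have hpos : ‖circleMap 0 1 φ - ⟨c, s⟩‖ * ‖circleMap 0 1 φ - ⟨c, -s⟩‖ ≠ 0 := by
      rw [hprod]; positivity
    rw [← Real.log_mul (left_ne_zero_of_mul hpos) (right_ne_zero_of_mul hpos), hprod,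
      Real.log_mul two_ne_zero hne, Real.log_abs]
    ring
  rw [this, intervalIntegral.integral_sub (i1.add i2) intervalIntegrable_const,
    intervalIntegral.integral_add i1 i2, e1, e2]
  simp

lemma integral_log_cos_sub_zero_pi {c : ℝ} (hc : c ∈ Icc (-1 : ℝ) 1) :
    ∫ φ in (0 : ℝ)..Real.pi, Real.log (Real.cos φ - c) = -(Real.pi * Real.log 2) := by
  have h := integral_log_cos_sub_zero_two_pi hc
  rw [← intervalIntegral.integral_add_adjacent_intervals
    (intervalIntegrable_log_cos_sub c 0 Real.pi)
    (intervalIntegrable_log_cos_sub c Real.pi (2 * Real.pi))] at h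
  have h2 := intervalIntegral.integral_comp_sub_left (a := 0) (b := Real.pi)
    (fun φ => Real.log (Real.cos φ - c)) (2 * Real.pi)
  simp only [Real.cos_two_pi_sub, sub_zero, show 2 * Real.pi - Real.pi = Real.pi by ring] at h2
  linarith

lemma one_add_cos_pos {φ : ℝ} (hφ : φ ∈ Ioo 0 Real.pi) : 0 < 1 + Real.cos φ := by
  have := Real.cos_lt_cos_of_nonneg_of_le_pi hφ.1.le le_rfl hφ.2
  rw [Real.cos_pi] at this
  linarith

lemma integral_log_sub_div_one_add_cos {x u : ℝ} (hx : 1 / 2 ≤ x) (hu : u ∈ Icc (0 : ℝ) 1) :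
    ∫ φ in (0 : ℝ)..Real.pi, Real.log (x - u / (1 + Real.cos φ)) = Real.pi * Real.log x := by
  have hx0 : 0 < x := by linarith
  have hc : u / x - 1 ∈ Icc (-1 : ℝ) 1 := by
    have h1 : u / x ≤ 2 := (div_le_iff₀ hx0).2 (by linarith [hu.2])
    have h2 : 0 ≤ u / x := div_nonneg hu.1 hx0.le
    constructor <;> linarith
  have hm : (-1 : ℝ) ∈ Icc (-1 : ℝ) 1 := by norm_num
  have : ∫ φ in (0 : ℝ)..Real.pi, Real.log (x - u / (1 + Real.cos φ)) =
      ∫ φ in (0 : ℝ)..Real.pi, ((Real.log x + Real.log (Real.cos φ - (u / x - 1))) -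
        Real.log (Real.cos φ - (-1))) := by
    apply intervalIntegral.integral_congr_ae
    filter_upwards [ae_cos_ne (u / x - 1), ae_cos_ne (-1)] with φ h1 h2 _
    have h1' := sub_ne_zero.2 h1
    have h2' := sub_ne_zero.2 h2
    rw [← Real.log_mul hx0.ne' h1', ← Real.log_div (mul_ne_zero hx0.ne' h1') h2']
    congr 1
    have h3 : 1 + Real.cos φ ≠ 0 := by intro h; apply h2; linarith
    rw [sub_neg_eq_add, add_comm (Real.cos φ) 1]
    field_simp
    ring
  have i (c : ℝ) := intervalIntegrable_log_cos_sub c 0 Real.pi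
  rw [this, intervalIntegral.integral_sub (intervalIntegrable_const.add (i _)) (i _),
    intervalIntegral.integral_add intervalIntegrable_const (i _),
    integral_log_cos_sub_zero_pi hc, integral_log_cos_sub_zero_pi hm]
  simp

lemma rho_eq_integral {y : ℝ} (hy : 0 < y) :
    rho y = Real.pi⁻¹ * ∫ φ in Ioo 0 Real.pi,
      if y * (1 + Real.cos φ) < 1 then 1 + Real.cos φ else 0 := by
  have hint (a : ℝ) : ∫ φ in a..Real.pi, (1 + Real.cos φ) = Real.pi - a - Real.sin a := by
    rw [intervalIntegral.integral_add (by simp) (by simp)]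
    simp
    ring
  have hpi := Real.pi_pos
  by_cases h : y ≤ 1 / 2
  · have : ∫ φ in Ioo 0 Real.pi, (if y * (1 + Real.cos φ) < 1 then 1 + Real.cos φ else 0) =
        ∫ φ in Ioo 0 Real.pi, (1 + Real.cos φ) := by
      refine setIntegral_congr_fun measurableSet_Ioo fun φ hφ => if_pos ?_
      have := Real.cos_lt_cos_of_nonneg_of_le_pi le_rfl hφ.2.le hφ.1
      rw [Real.cos_zero] at this
      nlinarith
    rw [this, ← integral_Ioc_eq_integral_Ioo, ← intervalIntegral.integral_of_le hpi.le, hint]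
    simp [rho, hy.not_gt, show y ≤ 2⁻¹ by linarith, hpi.ne']
  · push Not at h
    have hs : √(2 * y - 1) ^ 2 = 2 * y - 1 := Real.sq_sqrt (by linarith)
    have hs0 : 0 < √(2 * y - 1) := Real.sqrt_pos.2 (by linarith)
    have hrho : rho y = (2 / Real.pi) * (Real.arctan (1 / √(2 * y - 1)) -
        √(2 * y - 1) / (2 * y)) := by
      rw [rho, if_neg hy.not_gt, if_neg h.not_ge]
    rw [hrho]
    set s := √(2 * y - 1)
    have hys : 1 + s ^ 2 = 2 * y := by linarith
    set t := Real.arctan s with ht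
    have ht0 : 0 < t := Real.arctan_pos.2 hs0
    have ht1 : t < Real.pi / 2 := Real.arctan_lt_pi_div_two s
    have hcos2 : Real.cos t ^ 2 = 1 / (2 * y) := by rw [ht, Real.cos_sq_arctan, hys]
    have hsin : Real.sin (2 * t) = s / y := by
      have : Real.sin t = s * Real.cos t := by
        rw [← Real.tan_mul_cos (Real.cos_arctan_pos s).ne', Real.tan_arctan]
      rw [Real.sin_two_mul, this,
        show 2 * (s * Real.cos t) * Real.cos t = 2 * s * Real.cos t ^ 2 by ring, hcos2]
      field_simp
    have hcos : y * (1 + Real.cos (2 * t)) = 1 := by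
      rw [Real.cos_two_mul, hcos2]
      field_simp
      ring
    have hset : ∫ φ in Ioo 0 Real.pi, (if y * (1 + Real.cos φ) < 1 then 1 + Real.cos φ else 0) =
        ∫ φ in Ioo 0 Real.pi, (Ioo (2 * t) Real.pi).indicator (fun φ => 1 + Real.cos φ) φ := by
      refine setIntegral_congr_fun measurableSet_Ioo fun φ hφ => ?_
      have hiff : y * (1 + Real.cos φ) < 1 ↔ φ ∈ Ioo (2 * t) Real.pi := by
        rw [show y * (1 + Real.cos φ) < 1 ↔ y * (1 + Real.cos φ) < y * (1 + Real.cos (2 * t)) by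
          rw [hcos], mul_lt_mul_iff_right₀ hy, add_lt_add_iff_left,
          Real.strictAntiOn_cos.lt_iff_gt ⟨hφ.1.le, hφ.2.le⟩ ⟨by linarith, by linarith⟩]
        exact ⟨fun h => ⟨h, hφ.2⟩, fun h => h.1⟩
      simp only [hiff, indicator_apply]
    rw [hset, setIntegral_indicator measurableSet_Ioo,
      inter_eq_self_of_subset_right (Ioo_subset_Ioo_left (by linarith)),
      ← integral_Ioc_eq_integral_Ioo, ← intervalIntegral.integral_of_le (by linarith), hint, hsin,
      one_div, Real.arctan_inv_of_pos hs0, ← ht]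
    field_simp

lemma continuous_integral_abs_log_sub :
    Continuous fun a : ℝ => ∫ u in Ioc (0 : ℝ) 1, ‖Real.log (a - u)‖ := by
  have hP := intervalIntegral.continuous_primitive (f := fun w => ‖Real.log w‖) (μ := volume)
    (fun a b => intervalIntegral.intervalIntegrable_log'.norm) 0
  have h : (fun a : ℝ => ∫ u in Ioc (0 : ℝ) 1, ‖Real.log (a - u)‖) = fun a =>
      (∫ w in (0 : ℝ)..a, ‖Real.log w‖) - ∫ w in (0 : ℝ)..(a - 1), ‖Real.log w‖ := by
    ext a
    rw [intervalIntegral.integral_interval_sub_left intervalIntegral.intervalIntegrable_log'.norm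
      intervalIntegral.intervalIntegrable_log'.norm, ← intervalIntegral.integral_of_le zero_le_one,
      intervalIntegral.integral_comp_sub_left (fun w => ‖Real.log w‖) a, sub_zero]
  rw [h]
  exact hP.sub (hP.comp (continuous_id.sub continuous_const))

lemma integrable_log_sub_div_one_add_cos (x : ℝ) :
    Integrable (fun p : ℝ × ℝ => Real.log (x - p.2 / (1 + Real.cos p.1)))
      ((volume.restrict (Ioo 0 Real.pi)).prod (volume.restrict (Ioc 0 1))) := by
  have h1 : Integrable (fun p : ℝ × ℝ => Real.log (x * (1 + Real.cos p.1) - p.2))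
      ((volume.restrict (Ioo 0 Real.pi)).prod (volume.restrict (Ioc 0 1))) := by
    rw [integrable_prod_iff (Measurable.aestronglyMeasurable (by fun_prop))]
    constructor
    · refine Filter.Eventually.of_forall fun φ => ?_
      have : IntervalIntegrable (fun u => Real.log (x * (1 + Real.cos φ) - u)) volume 0 1 := by
        simpa using (intervalIntegral.intervalIntegrable_log'
          (a := x * (1 + Real.cos φ)) (b := x * (1 + Real.cos φ) - 1)).comp_sub_left
            (x * (1 + Real.cos φ))
      exact (intervalIntegrable_iff_integrableOn_Ioc_of_le zero_le_one).1 this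
    · have hc : Continuous fun φ : ℝ =>
          ∫ u in Ioc (0 : ℝ) 1, ‖Real.log (x * (1 + Real.cos φ) - u)‖ :=
        continuous_integral_abs_log_sub.comp (by fun_prop : Continuous fun φ : ℝ =>
          x * (1 + Real.cos φ))
      exact (hc.integrableOn_Icc (a := 0) (b := Real.pi)).mono_set Ioo_subset_Icc_self
  have h2 : Integrable (fun p : ℝ × ℝ => Real.log (1 + Real.cos p.1))
      ((volume.restrict (Ioo 0 Real.pi)).prod (volume.restrict (Ioc 0 1))) := by
    have := (intervalIntegrable_iff_integrableOn_Ioo_of_le Real.pi_pos.le).1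
      (intervalIntegrable_log_cos_sub (-1) 0 Real.pi)
    simp only [sub_neg_eq_add, add_comm _ (1 : ℝ)] at this
    exact Integrable.comp_fst this _
  refine (h1.norm.add h2.norm).mono' (Measurable.aestronglyMeasurable (by fun_prop)) ?_
  have hmem : ∀ᵐ p : ℝ × ℝ ∂((volume.restrict (Ioo 0 Real.pi)).prod
      (volume.restrict (Ioc (0 : ℝ) 1))), p.1 ∈ Ioo 0 Real.pi :=
    Measure.quasiMeasurePreserving_fst.ae (ae_restrict_mem measurableSet_Ioo)
  filter_upwards [hmem] with p hp
  have hv := one_add_cos_pos hp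
  simp only [Pi.add_apply]
  by_cases h0 : x * (1 + Real.cos p.1) - p.2 = 0
  · have : x - p.2 / (1 + Real.cos p.1) = 0 := by
      field_simp
      linarith
    rw [this]
    simp only [Real.log_zero, norm_zero]
    positivity
  · have : x - p.2 / (1 + Real.cos p.1) =
        (x * (1 + Real.cos p.1) - p.2) / (1 + Real.cos p.1) := by field_simp
    rw [this, Real.log_div h0 hv.ne']
    exact norm_sub_le _ _

lemma ite_mul_lt_one_mul_eq_indicator {v : ℝ} (hv : 0 < v) (f : ℝ → ℝ) (y : ℝ) :
    (if y * v < 1 then v else 0) * f y = (Iio v⁻¹).indicator (fun y => v * f y) y := by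
  rw [← one_div, indicator_apply]
  simp only [mem_Iio, lt_div_iff₀ hv]
  split_ifs <;> simp

lemma setIntegral_ite_mul_lt_one {v : ℝ} (hv : 0 < v) (f : ℝ → ℝ) :
    ∫ y in Ioi (0 : ℝ), (if y * v < 1 then v else 0) * f y = ∫ u in Ioc (0 : ℝ) 1, f (u / v) := by
  simp_rw [ite_mul_lt_one_mul_eq_indicator hv]
  rw [setIntegral_indicator measurableSet_Iio, Ioi_inter_Iio, ← integral_Ioc_eq_integral_Ioo,
    ← intervalIntegral.integral_of_le (inv_nonneg.2 hv.le),
    ← intervalIntegral.integral_of_le zero_le_one,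
    intervalIntegral.integral_comp_div _ hv.ne', intervalIntegral.integral_const_mul]
  simp

lemma integrable_ite_mul_log_sub (x : ℝ) :
    Integrable (fun p : ℝ × ℝ =>
      (if p.2 * (1 + Real.cos p.1) < 1 then 1 + Real.cos p.1 else 0) * Real.log (x - p.2))
      ((volume.restrict (Ioo 0 Real.pi)).prod (volume.restrict (Ioi 0))) := by
  have hmeas : Measurable fun p : ℝ × ℝ =>
      (if p.2 * (1 + Real.cos p.1) < 1 then 1 + Real.cos p.1 else 0) * Real.log (x - p.2) :=
    (Measurable.ite (measurableSet_lt (by fun_prop) (by fun_prop)) (by fun_prop)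
      (by fun_prop)).mul (by fun_prop)
  rw [integrable_prod_iff hmeas.aestronglyMeasurable]
  constructor
  · filter_upwards [ae_restrict_mem measurableSet_Ioo] with φ hφ
    have hv := one_add_cos_pos hφ
    simp_rw [ite_mul_lt_one_mul_eq_indicator hv fun y => Real.log (x - y)]
    rw [integrable_indicator_iff measurableSet_Iio, IntegrableOn,
      Measure.restrict_restrict measurableSet_Iio, inter_comm, Ioi_inter_Iio]
    have : IntervalIntegrable (fun u => Real.log (x - u)) volume 0 (1 + Real.cos φ)⁻¹ := by
      simpa using (intervalIntegral.intervalIntegrable_log'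
        (a := x) (b := x - (1 + Real.cos φ)⁻¹)).comp_sub_left x
    exact (((intervalIntegrable_iff_integrableOn_Ioo_of_le (inv_nonneg.2 hv.le)).1 this).const_mul _)
  · refine (integrable_log_sub_div_one_add_cos x).integral_norm_prod_left.congr ?_
    filter_upwards [ae_restrict_mem measurableSet_Ioo] with φ hφ
    have hv := one_add_cos_pos hφ
    rw [← setIntegral_ite_mul_lt_one hv fun y => ‖Real.log (x - y)‖]
    refine integral_congr_ae (Filter.Eventually.of_forall fun y => ?_)
    have : 0 ≤ (if y * (1 + Real.cos φ) < 1 then 1 + Real.cos φ else 0) := by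
      split_ifs <;> simp [hv.le]
    simp only [norm_mul, Real.norm_of_nonneg this]

theorem rho_log_x (x : ℝ) (hx : 1 / 2 ≤ x) :
    ∫ y in Set.Ioi (0 : ℝ), rho y * Real.log |x - y| = Real.log x := by
  calc ∫ y in Ioi (0 : ℝ), rho y * Real.log |x - y|
      = ∫ y in Ioi (0 : ℝ), Real.pi⁻¹ * ∫ φ in Ioo 0 Real.pi,
          (if y * (1 + Real.cos φ) < 1 then 1 + Real.cos φ else 0) * Real.log (x - y) := by
        refine setIntegral_congr_fun measurableSet_Ioi fun y hy => ?_
        rw [rho_eq_integral hy, Real.log_abs, integral_mul_const, mul_assoc]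
    _ = Real.pi⁻¹ * ∫ φ in Ioo 0 Real.pi, ∫ y in Ioi (0 : ℝ),
          (if y * (1 + Real.cos φ) < 1 then 1 + Real.cos φ else 0) * Real.log (x - y) := by
        rw [integral_const_mul, ← integral_integral_swap (integrable_ite_mul_log_sub x)]
    _ = Real.pi⁻¹ * ∫ φ in Ioo 0 Real.pi, ∫ u in Ioc (0 : ℝ) 1,
          Real.log (x - u / (1 + Real.cos φ)) := by
        congr 1
        exact setIntegral_congr_fun measurableSet_Ioo fun φ hφ =>
          setIntegral_ite_mul_lt_one (one_add_cos_pos hφ) fun y => Real.log (x - y)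
    _ = Real.pi⁻¹ * ∫ u in Ioc (0 : ℝ) 1, ∫ φ in Ioo 0 Real.pi,
          Real.log (x - u / (1 + Real.cos φ)) := by
        rw [integral_integral_swap (integrable_log_sub_div_one_add_cos x)]
    _ = Real.pi⁻¹ * ∫ u in Ioc (0 : ℝ) 1, Real.pi * Real.log x := by
        congr 1
        refine setIntegral_congr_fun measurableSet_Ioc fun u hu => ?_
        rw [← integral_Ioc_eq_integral_Ioo, ← intervalIntegral.integral_of_le Real.pi_pos.le,
          integral_log_sub_div_one_add_cos hx (Ioc_subset_Icc_self hu)]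
    _ = Real.log x := by simp [Real.pi_ne_zero]
end
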